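/- arXiv:1412.8259 — 6 statements merged into one kernel-verified Lean document; each statement's English description precedes it below -/
import Mathlib

section
/- For all integers n and k with 0 ≤ k ≤ n, the value of the n-th Daehee polynomial at the integer k is D_n(k) = ∑_{i=0}^k C(k,i) · n(n−1)⋯(n−i+1) · D_{n−i}, where n(n−1)⋯(n−i+1) is the falling factorial (equal to 1 when i = 0). -/
/-- The Daehee numbers `D_n = (-1)^n * n! / (n+1)`. -/
noncomputable def daehee (n : ℕ) : ℝ := (-1) ^ n * (n.factorial : ℝ) / (n + 1)

/-- The falling factorial `x(x-1)⋯(x-m+1)` of a real number `x` (empty product is 1). -/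
noncomputable def fallFac (x : ℝ) (m : ℕ) : ℝ := ∏ i ∈ Finset.range m, (x - i)

/-- The Daehee polynomials `D_n(x) = ∑_{m=0}^n C(n,m) D_{n-m} x(x-1)⋯(x-m+1)`. -/
noncomputable def daeheePoly (n : ℕ) (x : ℝ) : ℝ :=
  ∑ m ∈ Finset.range (n + 1), (n.choose m : ℝ) * daehee (n - m) * fallFac x m

lemma fallFac_nat (k m : ℕ) : fallFac (k : ℝ) m = (m.factorial : ℝ) * (k.choose m : ℝ) := by
  rw [← Nat.cast_mul, ← Nat.descFactorial_eq_factorial_mul_choose]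
  induction m with
  | zero => simp [fallFac]
  | succ m ih =>
    have h : fallFac (k : ℝ) (m + 1) = fallFac (k : ℝ) m * ((k : ℝ) - m) := by
      simp [fallFac, Finset.prod_range_succ]
    rw [h, ih, Nat.descFactorial_succ]
    rcases le_or_gt m k with hm | hm
    · push_cast [Nat.cast_sub hm]
      ring
    · simp [Nat.descFactorial_eq_zero_iff_lt.2 hm]

theorem daeheePoly_eval_nat (n k : ℕ) (hk : k ≤ n) :
    daeheePoly n (k : ℝ) =
      ∑ i ∈ Finset.range (k + 1), (k.choose i : ℝ) * fallFac (n : ℝ) i * daehee (n - i) := by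
  unfold daeheePoly
  symm
  have hs : Finset.range (k + 1) ⊆ Finset.range (n + 1) := by
    intro x hx
    simp only [Finset.mem_range] at *
    omega
  rw [← Finset.sum_subset hs]
  · apply Finset.sum_congr rfl
    intro i _
    rw [fallFac_nat, fallFac_nat]
    ring
  · intro x _ hx
    have : k < x := by
      simp only [Finset.mem_range] at hx
      omega
    rw [fallFac_nat, Nat.choose_eq_zero_of_lt this]
    simp
end

section
/- For every integer n ≥ 0, the Daehee numbers satisfy D_n = ∑_{l=0}^n s₁(n,l) · B_l. -/
/-- The signed Stirling numbers of the first kind, given as the coefficients of the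
falling-factorial polynomial `X(X-1)⋯(X-n+1) = ∑_{l=0}^n s₁(n,l) X^l`. -/
noncomputable def s1 (n l : ℕ) : ℝ := (descPochhammer ℝ n).coeff l

open Polynomial in
noncomputable def daeheeL : ℝ[X] →ₗ[ℝ] ℝ :=
  Polynomial.lsum (fun l => (LinearMap.mulRight ℝ ((bernoulli l : ℚ) : ℝ)))

open Polynomial in
theorem daeheeL_monomial (n : ℕ) (a : ℝ) : daeheeL (monomial n a) = a * (bernoulli n : ℝ) := by
  simp [daeheeL, Polynomial.lsum_apply, Polynomial.sum_monomial_index]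

open Polynomial in
theorem daeheeL_shift (p : ℝ[X]) : daeheeL (p.comp (X + 1)) = daeheeL p + p.coeff 1 := by
  induction p using Polynomial.induction_on' with
  | add p q hp hq => simp only [add_comp, map_add, coeff_add, hp, hq]; ring
  | monomial n a =>
    have h1 : (monomial n a).comp (X + 1 : ℝ[X])
        = ∑ k ∈ Finset.range (n + 1), monomial k (a * (n.choose k : ℝ)) := by
      rw [monomial_comp, add_pow, Finset.mul_sum]
      refine Finset.sum_congr rfl fun k _ => ?_
      rw [← C_mul_X_pow_eq_monomial, C_mul, one_pow, mul_one, ← C_eq_natCast]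
      simp only [map_natCast]
      ring
    have h2 := congrArg (fun q : ℚ => (q : ℝ)) (sum_bernoulli n)
    push_cast at h2
    rw [h1, map_sum]
    simp only [daeheeL_monomial]
    rw [Finset.sum_range_succ, Nat.choose_self, coeff_monomial]
    simp only [mul_assoc]
    rw [← Finset.mul_sum, h2]
    split_ifs <;> simp; ring

open Polynomial in
theorem descPochhammer_shift (n : ℕ) : (descPochhammer ℝ (n + 1)).comp (X + 1)
    = descPochhammer ℝ (n + 1) + (n + 1 : ℝ) • descPochhammer ℝ n := by
  have h := congrArg (fun q : ℝ[X] => q.comp (X + 1)) (descPochhammer_succ_comp_X_sub_one (R := ℝ) n)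
  have e : ((n : ℝ[X]) + 1).comp (X + 1) = C (n + 1 : ℝ) := by simp
  simp only [smul_eq_mul, mul_comp, comp_assoc, sub_comp, X_comp, one_comp, add_sub_cancel_right,
    comp_X, e] at h
  rw [smul_eq_C_mul]
  linear_combination -h

open Polynomial in
theorem descPochhammer_coeff_one (n : ℕ) :
    (descPochhammer ℝ (n + 1)).coeff 1 = (-1) ^ n * (n.factorial : ℝ) := by
  induction n with
  | zero => simp
  | succ n ih =>
    have h0 : (descPochhammer ℝ (n + 1)).coeff 0 = 0 := by
      rw [coeff_zero_eq_eval_zero, descPochhammer_ne_zero_eval_zero _ (Nat.succ_ne_zero n)]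
    rw [descPochhammer_succ_right, mul_sub, coeff_sub, coeff_mul_X, h0, ← C_eq_natCast,
      coeff_mul_C, ih, Nat.factorial_succ]
    push_cast
    ring

theorem daehee_eq_sum_stirling_bernoulli (n : ℕ) :
    daehee n = ∑ l ∈ Finset.range (n + 1), s1 n l * (bernoulli l : ℝ) := by
  have h := daeheeL_shift (descPochhammer ℝ (n + 1))
  rw [descPochhammer_shift, map_add, map_smul, descPochhammer_coeff_one] at h
  have h3 : daeheeL (descPochhammer ℝ n)
      = ∑ l ∈ Finset.range (n + 1), s1 n l * (bernoulli l : ℝ) := by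
    conv_lhs => rw [(descPochhammer ℝ n).as_sum_range, descPochhammer_natDegree]
    rw [map_sum]
    simp only [daeheeL_monomial, s1]
  rw [← h3, daehee, div_eq_iff (by positivity)]
  simp only [smul_eq_mul] at h
  linarith
end

section
/- For every integer n ≥ 0 and every real number x, the Daehee polynomials satisfy D_n(x) = ∑_{l=0}^n s₁(n,l) · B_l(x). -/
/-- The Bernoulli polynomial `B_n(x)` (with `B_1(0) = -1/2`), evaluated at a real `x`. -/
noncomputable def bernoulliPoly (n : ℕ) (x : ℝ) : ℝ := Polynomial.aeval x (Polynomial.bernoulli n)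

noncomputable def bT (x : ℝ) : Polynomial ℝ →ₗ[ℝ] ℝ :=
  Polynomial.lsum (fun l => (LinearMap.id : ℝ →ₗ[ℝ] ℝ).smulRight (bernoulliPoly l x))

lemma bT_monomial (x : ℝ) (l : ℕ) (a : ℝ) :
    bT x (Polynomial.monomial l a) = a * bernoulliPoly l x := by
  simp [bT, Polynomial.lsum_apply, Polynomial.sum_monomial_index]

lemma bT_X_pow (x : ℝ) (l : ℕ) : bT x (Polynomial.X ^ l) = bernoulliPoly l x := by
  rw [Polynomial.X_pow_eq_monomial, bT_monomial, one_mul]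

lemma bern_sum (x : ℝ) (n : ℕ) :
    ∑ k ∈ Finset.range (n + 1), ((n + 1).choose k : ℝ) * bernoulliPoly k x = (n + 1) * x ^ n := by
  have h := congrArg (Polynomial.aeval x) (Polynomial.sum_bernoulli n)
  rw [map_sum] at h
  simpa [bernoulliPoly, Polynomial.aeval_monomial, Algebra.smul_def, add_mul] using h

lemma bT_delta_pow (x : ℝ) (l : ℕ) :
    bT x ((Polynomial.X + 1) ^ l) = bernoulliPoly l x + l * x ^ (l - 1) := by
  have key : ((Polynomial.X + 1 : Polynomial ℝ) ^ l) =
      ∑ k ∈ Finset.range (l + 1), (l.choose k : ℝ) • Polynomial.X ^ k := by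
    rw [add_pow]
    refine Finset.sum_congr rfl fun k _ => ?_
    rw [Polynomial.smul_eq_C_mul]
    simp [mul_comm]
  rw [key, map_sum]
  simp only [map_smul, bT_X_pow, smul_eq_mul]
  rw [Finset.sum_range_succ]
  cases l with
  | zero => simp
  | succ n => rw [bern_sum]; simp; ring

lemma bT_delta (x : ℝ) (p : Polynomial ℝ) :
    bT x (p.comp (Polynomial.X + 1)) = bT x p + p.derivative.eval x := by
  induction p using Polynomial.induction_on' with
  | add p q hp hq => simp only [Polynomial.add_comp, map_add, hp, hq, Polynomial.eval_add]; ring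
  | monomial l a =>
    rw [Polynomial.monomial_comp, ← Polynomial.smul_eq_C_mul, map_smul, bT_delta_pow, bT_monomial,
      Polynomial.derivative_monomial, Polynomial.eval_monomial, smul_eq_mul]
    ring

lemma desc_delta (n : ℕ) : (descPochhammer ℝ (n + 1)).comp (Polynomial.X + 1) =
    descPochhammer ℝ (n + 1) + ((n : ℝ) + 1) • descPochhammer ℝ n := by
  have h := congrArg (fun p => Polynomial.comp p (Polynomial.X + 1))
    (descPochhammer_succ_comp_X_sub_one (R := ℝ) n)
  simp only [Polynomial.comp_assoc, smul_eq_mul, Polynomial.mul_comp, Polynomial.add_comp,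
    Polynomial.natCast_comp, Polynomial.sub_comp, Polynomial.X_comp,
    Polynomial.one_comp, add_sub_cancel_right, Polynomial.comp_X] at h
  rw [Polynomial.smul_eq_C_mul]
  simp only [map_add, map_natCast, map_one]
  linear_combination -h

lemma bT_desc (x : ℝ) (n : ℕ) : ((n : ℝ) + 1) * bT x (descPochhammer ℝ n) =
    (descPochhammer ℝ (n + 1)).derivative.eval x := by
  have h := bT_delta x (descPochhammer ℝ (n + 1))
  rw [desc_delta, map_add, map_smul, smul_eq_mul] at h
  linarith

lemma bT_desc_sum (x : ℝ) (n : ℕ) : bT x (descPochhammer ℝ n) =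
    ∑ l ∈ Finset.range (n + 1), s1 n l * bernoulliPoly l x := by
  rw [bT, Polynomial.lsum_apply, Polynomial.sum_over_range _ (by simp), descPochhammer_natDegree]
  simp [s1]

lemma fall_deriv (x : ℝ) (N : ℕ) : (descPochhammer ℝ N).derivative.eval x =
    ∑ m ∈ Finset.range N, (N.choose m : ℝ) * ((-1) ^ (N - m - 1) * ((N - m - 1).factorial : ℝ))
      * fallFac x m := by
  induction N with
  | zero => simp
  | succ N ih =>
    have hP : (descPochhammer ℝ N).eval x = fallFac x N := by
      rw [descPochhammer_eval_eq_prod_range, fallFac]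
    have h1 : (descPochhammer ℝ (N + 1)).derivative.eval x =
        (descPochhammer ℝ N).derivative.eval x * (x - N) + fallFac x N := by
      rw [descPochhammer_succ_right, Polynomial.derivative_mul, ← hP]
      simp
    have h2 : ∀ m ∈ Finset.range N,
        (N.choose m : ℝ) * ((-1) ^ (N - m - 1) * ((N - m - 1).factorial : ℝ))
          * fallFac x m * (x - N) =
        (N.choose m : ℝ) * ((-1) ^ (N - m - 1) * ((N - m - 1).factorial : ℝ)) * fallFac x (m + 1)
        + (N.choose m : ℝ) * ((-1) ^ (N - m) * ((N - m).factorial : ℝ)) * fallFac x m := by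
      intro m hm
      obtain ⟨k, rfl⟩ := Nat.exists_eq_add_of_lt (Finset.mem_range.1 hm)
      have e1 : m + k + 1 - m = k + 1 := by omega
      have e2 : fallFac x (m + 1) = fallFac x m * (x - m) := by
        simp [fallFac, Finset.prod_range_succ]
      rw [e1, e2, Nat.add_sub_cancel, Nat.factorial_succ]
      push_cast
      ring
    rw [h1, ih, Finset.sum_mul, Finset.sum_congr rfl h2, Finset.sum_add_distrib]
    have h3 : ∑ m ∈ Finset.range N,
        (N.choose m : ℝ) * ((-1) ^ (N - m) * ((N - m).factorial : ℝ)) * fallFac x m + fallFac x N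
        = ∑ m ∈ Finset.range (N + 1),
        (N.choose m : ℝ) * ((-1) ^ (N - m) * ((N - m).factorial : ℝ)) * fallFac x m := by
      rw [Finset.sum_range_succ]; simp
    rw [add_assoc, h3, Finset.sum_range_succ', Finset.sum_range_succ' _ N, ← add_assoc,
      ← Finset.sum_add_distrib]
    congr 1
    · refine Finset.sum_congr rfl fun m _ => ?_
      rw [Nat.choose_succ_succ, Nat.add_sub_add_right, Nat.sub_sub]
      push_cast
      ring
    · simp

theorem daeheePoly_eq_sum_stirling_bernoulliPoly (n : ℕ) (x : ℝ) :
    daeheePoly n x = ∑ l ∈ Finset.range (n + 1), s1 n l * bernoulliPoly l x := by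
  have hn : ((n : ℝ) + 1) ≠ 0 := by positivity
  rw [← bT_desc_sum]
  apply mul_left_cancel₀ hn
  rw [bT_desc, fall_deriv, daeheePoly, Finset.mul_sum]
  refine Finset.sum_congr rfl fun m hm => ?_
  obtain ⟨k, rfl⟩ := Nat.exists_eq_add_of_le (Nat.lt_succ_iff.1 (Finset.mem_range.1 hm))
  have e1 : m + k - m = k := by omega
  have e2 : m + k + 1 - m - 1 = k := by omega
  have hc : ((m + k + 1 : ℕ) : ℝ) * ((m + k).choose m : ℝ) =
      ((m + k + 1).choose m : ℝ) * ((k : ℝ) + 1) := by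
    have := Nat.add_one_mul_choose_eq (m + k) k
    rw [← Nat.choose_symm_add, ← Nat.choose_symm_of_eq_add (show m + k + 1 = m + (k + 1) by ring)] at this
    exact_mod_cast this
  have hk : ((k : ℝ) + 1) ≠ 0 := by positivity
  rw [e1, e2, daehee]
  push_cast at hc ⊢
  field_simp
  linear_combination (fallFac x m) * hc
end

section
/- For every integer n ≥ 0, the Daehee numbers of the second kind satisfy D̂_n = ∑_{l=0}^n s₁(n,l) · (−1)^l · B_l. -/
/-- The Daehee numbers of the second kind: `D̂_0 = 1` and
`D̂_n = (-1)^(n-1) * n! / (n(n+1))` for `n ≥ 1`. -/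
noncomputable def daehee2 (n : ℕ) : ℝ :=
  if n = 0 then 1 else (-1) ^ (n - 1) * (n.factorial : ℝ) / (n * (n + 1))

open Polynomial in
noncomputable def umbL : ℝ[X] →ₗ[ℝ] ℝ :=
  Polynomial.lsum (fun l => ((bernoulli' l : ℚ) : ℝ) • (LinearMap.id : ℝ →ₗ[ℝ] ℝ))

open Polynomial in
lemma umbL_monomial (n : ℕ) (a : ℝ) : umbL (monomial n a) = a * (bernoulli' n : ℝ) := by
  simp [umbL, Polynomial.lsum_apply, Polynomial.sum_monomial_index, mul_comm]

open Polynomial in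
lemma umbL_X_pow (n : ℕ) : umbL (X ^ n) = (bernoulli' n : ℝ) := by
  rw [X_pow_eq_monomial, umbL_monomial, one_mul]

open Polynomial in
lemma umbL_shift (p : ℝ[X]) :
    umbL (p.comp (X + 1)) = umbL p + (derivative p).eval 1 := by
  induction p using Polynomial.induction_on' with
  | add p q hp hq => simp only [add_comp, map_add, hp, hq, eval_add]; ring
  | monomial n a =>
    have h1 : umbL ((X + 1 : ℝ[X]) ^ n) = bernoulli' n + n := by
      rw [add_pow, map_sum]
      have : ∀ k ∈ Finset.range (n + 1),
          umbL (X ^ k * 1 ^ (n - k) * ((n.choose k : ℕ) : ℝ[X])) = n.choose k * bernoulli' k := by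
        intro k _
        rw [one_pow, mul_one, mul_comm, ← nsmul_eq_mul, map_nsmul, umbL_X_pow, nsmul_eq_mul]
      rw [Finset.sum_congr rfl this, Finset.sum_range_succ]
      have h := congrArg (fun q : ℚ => (q : ℝ)) (sum_bernoulli' n)
      push_cast at h
      rw [h]; simp [add_comm]
    rw [monomial_comp, ← smul_eq_C_mul, map_smul, h1, umbL_monomial, derivative_monomial]
    simp
    ring

open Polynomial in
lemma deriv_desc (k : ℕ) : (descPochhammer ℝ (k + 2)).eval 1 = 0 ∧
    (derivative (descPochhammer ℝ (k + 2))).eval 1 = (-1) ^ k * (k.factorial : ℝ) := by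
  induction k with
  | zero => simp [descPochhammer_succ_right]
  | succ k ih =>
    rw [descPochhammer_succ_right ℝ (k + 2)]
    constructor
    · simp [ih.1]
    · simp only [derivative_mul, eval_add, eval_mul, ih.1, ih.2]
      simp [Nat.factorial_succ, pow_succ]
      ring

open Polynomial in
lemma umbL_desc (n : ℕ) : (n + 1) * umbL (descPochhammer ℝ n) =
    (derivative (descPochhammer ℝ (n + 1))).eval 1 := by
  have h := congrArg (fun q => q.comp (X + 1)) (descPochhammer_succ_comp_X_sub_one (R := ℝ) n)
  simp only [comp_assoc, sub_comp, smul_eq_mul, mul_comp, add_comp, natCast_comp, X_comp, one_comp, add_sub_cancel_right, comp_X] at h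
  have h2 := congrArg umbL h
  have h3 : ((n : ℝ[X]) + 1) * descPochhammer ℝ n = (n + 1) • descPochhammer ℝ n := by
    rw [nsmul_eq_mul]; push_cast; rfl
  rw [h3, map_sub, umbL_shift, map_nsmul, nsmul_eq_mul] at h2
  push_cast at h2
  linarith

theorem daehee2_eq_sum_stirling_bernoulli (n : ℕ) :
    daehee2 n = ∑ l ∈ Finset.range (n + 1), s1 n l * (-1) ^ l * (bernoulli l : ℝ) := by
  have key : umbL (descPochhammer ℝ n) =
      ∑ l ∈ Finset.range (n + 1), s1 n l * (-1) ^ l * (bernoulli l : ℝ) := by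
    conv_lhs => rw [Polynomial.as_sum_range' (descPochhammer ℝ n) (n + 1) (by simp)]
    rw [map_sum]
    refine Finset.sum_congr rfl fun l _ => ?_
    rw [umbL_monomial, bernoulli'_eq_bernoulli, s1]
    push_cast
    ring
  rw [← key]
  have h := umbL_desc n
  rcases n with _ | k
  · simp at h
    simp [daehee2, h]
  · rw [(deriv_desc k).2] at h
    have h1 : ((k : ℝ) + 1) ≠ 0 := by positivity
    have h2 : ((k : ℝ) + 1 + 1) ≠ 0 := by positivity
    simp only [daehee2, Nat.factorial_succ]
    push_cast at h ⊢
    rw [div_eq_iff (by positivity)]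
    linear_combination (-(k + 1 : ℝ)) * h
end

section
/- For every integer n ≥ 0 and every real number x, the Daehee polynomials of the second kind satisfy D̂_n(x) = ∑_{l=0}^n s₁(n,l) · (−1)^l · B_l(x). -/
/-- The Daehee polynomials of the second kind
`D̂_n(x) = ∑_{m=0}^n C(n,m) D̂_{n-m} (-x)(-x-1)⋯(-x-m+1)`. -/
noncomputable def daeheePoly2 (n : ℕ) (x : ℝ) : ℝ :=
  ∑ m ∈ Finset.range (n + 1), (n.choose m : ℝ) * daehee2 (n - m) * fallFac (-x) m

open Polynomial in
theorem hh_fall (z : ℝ) (m : ℕ) : (descPochhammer ℝ m).eval z = fallFac z m := by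
  induction m with
  | zero => simp [fallFac]
  | succ k ih =>
    rw [descPochhammer_succ_eval, ih, fallFac, fallFac, Finset.prod_range_succ]

open Polynomial in
theorem hh_deriv (N : ℕ) : derivative (descPochhammer ℝ (N + 1)) =
    ∑ m ∈ Finset.range (N + 1),
      C (((N + 1).choose m : ℝ) * ((-1) ^ (N - m) * ((N - m).factorial : ℝ))) *
        descPochhammer ℝ m := by
  induction N with
  | zero => simp
  | succ N ih =>
    have h1 : derivative (descPochhammer ℝ (N + 1 + 1)) =
        descPochhammer ℝ (N + 1) + (X - ((N + 1 : ℕ) : ℝ[X])) *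
          derivative (descPochhammer ℝ (N + 1)) := by
      rw [descPochhammer_succ_right ℝ (N + 1)]
      simp only [derivative_mul, derivative_sub, derivative_X, derivative_natCast]
      ring
    rw [h1, ih, Finset.mul_sum]
    have h2 : ∀ m ∈ Finset.range (N + 1), (X - ((N + 1 : ℕ) : ℝ[X])) *
        (C (((N + 1).choose m : ℝ) * ((-1) ^ (N - m) * ((N - m).factorial : ℝ))) *
        descPochhammer ℝ m) =
        C (((N + 1).choose m : ℝ) * ((-1) ^ (N - m) * ((N - m).factorial : ℝ))) *
          descPochhammer ℝ (m + 1) +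
        C (((N + 1).choose m : ℝ) * ((-1) ^ (N + 1 - m) * ((N + 1 - m).factorial : ℝ))) *
          descPochhammer ℝ m := by
      intro m hm
      obtain ⟨j, rfl⟩ := Nat.exists_eq_add_of_le (Nat.lt_succ_iff.mp (Finset.mem_range.mp hm))
      have e1 : m + j - m = j := by omega
      have e2 : m + j + 1 - m = j + 1 := by omega
      rw [e1, e2, descPochhammer_succ_right, Nat.factorial_succ]
      simp only [map_mul, map_pow, map_neg, map_one, Nat.cast_mul, map_natCast]
      push_cast
      ring
    rw [Finset.sum_congr rfl h2, Finset.sum_add_distrib]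
    rw [Finset.sum_range_succ' _ (N + 1)]
    have h3 : ∀ m ∈ Finset.range (N + 1),
        C (((N + 1 + 1).choose (m + 1) : ℝ) * ((-1) ^ (N + 1 - (m + 1)) *
          ((N + 1 - (m + 1)).factorial : ℝ))) * descPochhammer ℝ (m + 1) =
        C (((N + 1).choose m : ℝ) * ((-1) ^ (N - m) * ((N - m).factorial : ℝ))) *
          descPochhammer ℝ (m + 1) +
        C (((N + 1).choose (m + 1) : ℝ) * ((-1) ^ (N + 1 - (m + 1)) *
          ((N + 1 - (m + 1)).factorial : ℝ))) * descPochhammer ℝ (m + 1) := by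
      intro m hm
      rw [Nat.choose_succ_succ' (N + 1) m, Nat.add_sub_add_right]
      rw [← add_mul, ← C_add]
      push_cast
      ring_nf
    rw [Finset.sum_congr rfl h3, Finset.sum_add_distrib]
    have h4 := Finset.sum_range_succ (fun m => C (((N + 1).choose m : ℝ) *
      ((-1) ^ (N + 1 - m) * ((N + 1 - m).factorial : ℝ))) * descPochhammer ℝ m) (N + 1)
    have h5 := Finset.sum_range_succ' (fun m => C (((N + 1).choose m : ℝ) *
      ((-1) ^ (N + 1 - m) * ((N + 1 - m).factorial : ℝ))) * descPochhammer ℝ m) (N + 1)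
    rw [h5] at h4
    simp only [Nat.choose_self, Nat.sub_self, Nat.choose_zero_right, Nat.factorial_zero,
      Nat.cast_one, pow_zero, mul_one, map_one, one_mul] at h4 ⊢
    linear_combination -h4

open Polynomial in
theorem hh_comp (n : ℕ) : (descPochhammer ℝ (n + 1)).comp (X + 1) =
    descPochhammer ℝ (n + 1) + (n + 1 : ℝ[X]) * descPochhammer ℝ n := by
  have h : (descPochhammer ℝ (n + 1)).comp (X + 1) = (X + 1) * descPochhammer ℝ n := by
    rw [descPochhammer_succ_left, mul_comp, comp_assoc]
    simp
  rw [h, descPochhammer_succ_right]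
  ring

open Polynomial in
noncomputable def hhL (y : ℝ) : ℝ[X] →ₗ[ℝ] ℝ :=
  Polynomial.lsum fun l => LinearMap.toSpanSingleton ℝ ℝ (bernoulliPoly l y)

open Polynomial in
theorem hhL_monomial (y : ℝ) (l : ℕ) (a : ℝ) :
    hhL y (monomial l a) = a * bernoulliPoly l y := by
  simp [hhL, Polynomial.lsum_apply, Polynomial.sum_monomial_index]

open Polynomial in
theorem hhL_shift (y : ℝ) (p : ℝ[X]) :
    hhL y (p.comp (X + 1)) = hhL y p + (derivative p).eval y := by
  induction p using Polynomial.induction_on' with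
  | add p q hp hq => simp only [add_comp, map_add, eval_add, hp, hq]; ring
  | monomial l a =>
    have h0 : (monomial l a).comp (X + 1 : ℝ[X]) =
        ∑ k ∈ Finset.range (l + 1), monomial k (a * (l.choose k : ℝ)) := by
      rw [monomial_comp, add_pow, Finset.mul_sum]
      refine Finset.sum_congr rfl fun k _ => ?_
      rw [← C_mul_X_pow_eq_monomial]
      simp
      ring
    rw [h0, map_sum, Finset.sum_range_succ]
    simp only [hhL_monomial]
    cases l with
    | zero => simp
    | succ l =>
      have := congrArg (aeval y) (Polynomial.sum_bernoulli l)
      simp only [map_sum, map_smul] at this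
      have h2 : ∑ k ∈ Finset.range (l + 1), ((l + 1).choose k : ℝ) * bernoulliPoly k y =
          (l + 1) * y ^ l := by
        simpa [bernoulliPoly, Algebra.smul_def, aeval_monomial, add_mul] using this
      simp only [mul_assoc, ← Finset.mul_sum, h2, derivative_monomial, eval_monomial]
      simp
      ring

open Polynomial in
theorem hhL_desc (y : ℝ) (n : ℕ) :
    (n + 1 : ℝ) * hhL y (descPochhammer ℝ n) =
      (derivative (descPochhammer ℝ (n + 1))).eval y := by
  have h := hhL_shift y (descPochhammer ℝ (n + 1))
  rw [hh_comp, map_add] at h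
  have h2 : (n + 1 : ℝ[X]) * descPochhammer ℝ n = (n + 1 : ℝ) • descPochhammer ℝ n := by
    rw [smul_eq_C_mul]; simp
  rw [h2, map_smul, smul_eq_mul] at h
  linarith

open Polynomial in
theorem hh_refl (l : ℕ) (x : ℝ) : bernoulliPoly l (1 - x) = (-1) ^ l * bernoulliPoly l x := by
  have := congrArg (aeval x) (Polynomial.bernoulli_comp_one_sub_X l)
  simpa [bernoulliPoly, aeval_comp] using this

open Polynomial in
theorem hh_rhs (n : ℕ) (x : ℝ) :
    ∑ l ∈ Finset.range (n + 1), s1 n l * (-1) ^ l * bernoulliPoly l x =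
      hhL (1 - x) (descPochhammer ℝ n) := by
  have hd : (descPochhammer ℝ n).natDegree < n + 1 := by
    rw [descPochhammer_natDegree]; omega
  conv_rhs => rw [Polynomial.as_sum_range' _ _ hd]
  rw [map_sum]
  refine Finset.sum_congr rfl fun l _ => ?_
  rw [hhL_monomial, hh_refl, s1, mul_assoc]

open Polynomial in
theorem hh_eval_shift (n : ℕ) (z : ℝ) :
    (derivative (descPochhammer ℝ (n + 1))).eval (z + 1) =
      (derivative (descPochhammer ℝ (n + 1))).eval z +
      (n + 1) * (derivative (descPochhammer ℝ n)).eval z := by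
  have h := congrArg (fun p => (derivative p).eval z) (hh_comp n)
  simp only [derivative_comp, derivative_mul, derivative_add, derivative_X, derivative_one,
    derivative_natCast, eval_add, eval_mul, eval_comp, eval_X, eval_one, eval_natCast,
    eval_zero] at h
  linarith

theorem hh_main (n : ℕ) (x : ℝ) : (n + 1 : ℝ) * daeheePoly2 n x =
    (Polynomial.derivative (descPochhammer ℝ (n + 1))).eval (-x + 1) := by
  rw [hh_eval_shift, hh_deriv]
  simp only [Polynomial.eval_finsetSum, Polynomial.eval_mul, Polynomial.eval_C, hh_fall]
  cases n with
  | zero => simp [daeheePoly2, daehee2, fallFac]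
  | succ n =>
    rw [hh_deriv]
    simp only [Polynomial.eval_finsetSum, Polynomial.eval_mul, Polynomial.eval_C, hh_fall]
    rw [daeheePoly2, Finset.sum_range_succ, Finset.sum_range_succ _ (n + 1), mul_add,
      Finset.mul_sum, Finset.mul_sum, add_right_comm, ← Finset.sum_add_distrib]
    congr 1
    · refine Finset.sum_congr rfl fun m hm => ?_
      obtain ⟨j, rfl⟩ := Nat.exists_eq_add_of_le (Nat.lt_succ_iff.mp (Finset.mem_range.mp hm))
      have e1 : m + j - m = j := by omega
      have e2 : m + j + 1 - m = j + 1 := by omega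
      have hc := Nat.choose_mul_succ_eq (m + j + 1) m
      have e3 : m + j + 1 + 1 - m = j + 2 := by omega
      rw [e3] at hc
      have hc' : ((m + j + 1).choose m : ℝ) * (m + j + 1 + 1) =
          ((m + j + 1 + 1).choose m : ℝ) * (j + 2) := by exact_mod_cast hc
      have hj : (j + 2 : ℝ) ≠ 0 := by positivity
      have hc2 : ((m + j + 1 + 1).choose m : ℝ) =
          ((m + j + 1).choose m : ℝ) * (m + j + 1 + 1) / (j + 2) := by
        rw [eq_div_iff hj, hc']
      rw [e1, e2, hc2, daehee2, if_neg (Nat.succ_ne_zero j), Nat.factorial_succ]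
      have hj1 : (j + 1 : ℝ) ≠ 0 := by positivity
      have hj2 : (j + 1 + 1 : ℝ) ≠ 0 := by positivity
      simp only [Nat.add_sub_cancel]
      push_cast
      field_simp
      ring
    · simp [daehee2, Nat.choose_succ_self_right]

theorem daeheePoly2_eq_sum_stirling_bernoulliPoly (n : ℕ) (x : ℝ) :
    daeheePoly2 n x = ∑ l ∈ Finset.range (n + 1), s1 n l * (-1) ^ l * bernoulliPoly l x := by
  have hn : (n + 1 : ℝ) ≠ 0 := by positivity
  apply mul_left_cancel₀ hn
  rw [hh_main, hh_rhs, hhL_desc, neg_add_eq_sub]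
end

section
/- Let ξ be a nonzero real number. For every integer m ≥ 0 and every real number x, the Bernoulli polynomials satisfy B_m(x) = ∑_{n=0}^m s₂(m,n) · ξ^{−n} · D_{n,ξ}(x). -/
/-- The twisted Daehee polynomials `D_{n,ξ}(x) = ξ^n D_n(x)`. -/
noncomputable def twistedDaeheePoly (ξ : ℝ) (n : ℕ) (x : ℝ) : ℝ := ξ ^ n * daeheePoly n x

/-- The Stirling numbers of the second kind, defined by the recurrence
`s₂(m+1, n+1) = (n+1) s₂(m, n+1) + s₂(m, n)`; equivalently
`x^m = ∑_{n=0}^m s₂(m,n) x(x-1)⋯(x-n+1)`. -/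
noncomputable def s2 : ℕ → ℕ → ℝ
  | 0, 0 => 1
  | 0, _ + 1 => 0
  | _ + 1, 0 => 0
  | m + 1, n + 1 => (n + 1 : ℝ) * s2 m (n + 1) + s2 m n

open Polynomial in
/-- Bernoulli umbral functional. -/
noncomputable def berL : ℝ[X] →ₗ[ℝ] ℝ :=
  Polynomial.lsum fun m => ((bernoulli m : ℚ) : ℝ) • LinearMap.id

/-- Falling factorial in a commutative ring. -/
def gfall {R : Type*} [CommRing R] (y : R) (n : ℕ) : R := ∏ i ∈ Finset.range n, (y - (i : R))

open Polynomial in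
theorem berL_X_pow (m : ℕ) : berL (X ^ m) = ((bernoulli m : ℚ) : ℝ) := by
  simp [berL, Polynomial.lsum_apply, X_pow_eq_monomial, Polynomial.sum_monomial_index]

open Polynomial in
theorem berL_add_one (p : ℝ[X]) :
    berL (p.comp (X + 1)) - berL p = (derivative p).eval 0 := by
  induction p using Polynomial.induction_on' with
  | add p q hp hq =>
    simp only [add_comp, map_add, eval_add, ← hp, ← hq]; ring
  | monomial m a =>
    rw [← C_mul_X_pow_eq_monomial]
    simp only [← smul_eq_C_mul]
    simp only [smul_comp, pow_comp, X_comp, map_smul, eval_smul, ← smul_sub]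
    congr 1
    have h : (X + 1 : ℝ[X]) ^ m = ∑ k ∈ Finset.range (m+1), (m.choose k : ℝ) • X ^ k := by
      rw [add_pow]
      refine Finset.sum_congr rfl fun k _ => ?_
      rw [smul_eq_C_mul]; simp [mul_comm]
    rw [h, map_sum]
    simp only [map_smul, berL_X_pow]
    rw [Finset.sum_range_succ]
    have := congrArg (fun q : ℚ => (q : ℝ)) (sum_bernoulli m)
    push_cast at this
    simp only [smul_eq_mul, Nat.choose_self, Nat.cast_one, one_mul, add_sub_cancel_right]
    rw [this, derivative_X_pow]
    rcases m with _ | _ | m <;> simp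

theorem gfall_succ {R : Type*} [CommRing R] (y : R) (n : ℕ) :
    gfall y (n+1) = gfall y n * (y - n) := Finset.prod_range_succ _ _

theorem gfall_succ_left {R : Type*} [CommRing R] (y : R) (n : ℕ) :
    gfall (y + 1) (n+1) = (y + 1) * gfall y n := by
  unfold gfall
  rw [Finset.prod_range_succ', mul_comm]
  simp

open Polynomial in
theorem berL_gfall (n : ℕ) : berL (gfall X n) = daehee n := by
  have h := berL_add_one (gfall X (n+1))
  have hc : (gfall (X:ℝ[X]) (n+1)).comp (X+1) = gfall (X+1) (n+1) := by
    simp [gfall, Polynomial.prod_comp]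
  have hd : (gfall (X+1:ℝ[X]) (n+1)) - gfall X (n+1) = ((n:ℝ)+1) • gfall X n := by
    rw [gfall_succ_left, gfall_succ, smul_eq_C_mul]
    simp
    ring
  have he : ∀ n : ℕ, (derivative (gfall (X:ℝ[X]) (n+1))).eval 0 = (-1)^n * (n.factorial : ℝ) := by
    intro n
    induction n with
    | zero => simp [gfall]
    | succ n ih =>
      rw [gfall_succ, derivative_mul, eval_add, eval_mul, ih, eval_mul]
      have : eval 0 (gfall (X:ℝ[X]) (n+1)) = 0 := by
        simp [gfall, eval_prod, Finset.prod_range_succ']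
      rw [this]
      simp [Nat.factorial_succ]
      ring
  rw [hc, ← map_sub, hd, map_smul, he, smul_eq_mul] at h
  unfold daehee
  rw [eq_div_iff (by positivity), ← h, mul_comm]

theorem smeval_gfall {R : Type*} [CommRing R] (y : R) (n : ℕ) :
    (descPochhammer ℤ n).smeval y = gfall y n := by
  rw [← Polynomial.aeval_eq_smeval]
  induction n with
  | zero => simp [gfall]
  | succ n ih => rw [descPochhammer_succ_right, map_mul, ih, gfall_succ]; simp

theorem gfall_add {R : Type*} [CommRing R] (x y : R) (n : ℕ) :
    gfall (x + y) n = ∑ m ∈ Finset.range (n+1), (n.choose m : R) * (gfall x m * gfall y (n - m)) := by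
  have := Ring.descPochhammer_smeval_add n (Commute.all x y)
  simp only [smeval_gfall] at this
  rw [this, Finset.Nat.sum_antidiagonal_eq_sum_range_succ_mk]

open Polynomial in
theorem berL_gfall_add (n : ℕ) (x : ℝ) : berL (gfall (C x + X) n) = daeheePoly n x := by
  rw [gfall_add, map_sum, daeheePoly]
  refine Finset.sum_congr rfl fun m _ => ?_
  have h : gfall (C x) m = C (fallFac x m) := by
    simp [gfall, fallFac, map_prod]
  have h2 : ((n.choose m : ℝ[X]) * (gfall (C x) m * gfall X (n - m)))
      = ((n.choose m : ℝ) * fallFac x m) • gfall X (n-m) := by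
    rw [h, smul_eq_C_mul]; simp [mul_assoc]
  rw [h2, map_smul, berL_gfall, smul_eq_mul]; ring

theorem s2_lt : ∀ (m n : ℕ), m < n → s2 m n = 0
  | 0, 0, h => absurd h (lt_irrefl _)
  | 0, _ + 1, _ => by rw [s2]
  | _ + 1, 0, h => by omega
  | m + 1, n + 1, h => by
    rw [s2, s2_lt m (n+1) (by omega), s2_lt m n (by omega)]; simp

open Polynomial in
theorem pow_eq_gfall (y : ℝ[X]) (m : ℕ) :
    y ^ m = ∑ n ∈ Finset.range (m+1), s2 m n • gfall y n := by
  induction m with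
  | zero => simp [s2, gfall]
  | succ m ih =>
    have h1 : ∑ n ∈ Finset.range (m+1), ((n:ℝ)+1) • s2 m (n+1) • gfall y (n+1)
        = ∑ n ∈ Finset.range (m+1), (n:ℝ) • s2 m n • gfall y n := by
      have a := Finset.sum_range_succ' (fun n : ℕ => (n:ℝ) • s2 m n • gfall y n) (m+1)
      rw [Finset.sum_range_succ] at a
      simp only [s2_lt m (m+1) (by omega)] at a
      simpa using a.symm
    rw [Finset.sum_range_succ']
    have h2 : ∀ n : ℕ, s2 (m+1) (n+1) • gfall y (n+1)
        = ((n:ℝ)+1) • s2 m (n+1) • gfall y (n+1) + s2 m n • gfall y (n+1) := by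
      intro n
      rw [s2, add_smul, mul_smul]
    simp only [h2]
    rw [Finset.sum_add_distrib, h1, s2, zero_smul, add_zero]
    rw [pow_succ, ih, Finset.sum_mul, ← Finset.sum_add_distrib]
    refine Finset.sum_congr rfl fun n _ => ?_
    rw [gfall_succ]
    simp only [smul_eq_C_mul]
    simp
    ring

open Polynomial in
theorem bernoulliPoly_eq_berL (m : ℕ) (x : ℝ) : bernoulliPoly m x = berL ((C x + X) ^ m) := by
  rw [add_pow, map_sum, bernoulliPoly, Polynomial.bernoulli_def, map_sum]
  refine Finset.sum_congr rfl fun k _ => ?_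
  have : (C x ^ k * X ^ (m-k) * (m.choose k : ℝ[X])) = (x^k * (m.choose k : ℝ)) • X ^ (m-k) := by
    rw [smul_eq_C_mul]; simp; ring
  rw [this, map_smul, berL_X_pow, aeval_monomial]
  simp
  ring

theorem bernoulliPoly_eq_sum_stirling2_twistedDaeheePoly (ξ : ℝ) (hξ : ξ ≠ 0) (m : ℕ) (x : ℝ) :
    bernoulliPoly m x =
      ∑ n ∈ Finset.range (m + 1), s2 m n * (ξ ^ n)⁻¹ * twistedDaeheePoly ξ n x := by
  rw [bernoulliPoly_eq_berL, pow_eq_gfall, map_sum]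
  refine Finset.sum_congr rfl fun n _ => ?_
  rw [map_smul, berL_gfall_add, twistedDaeheePoly, smul_eq_mul]
  field_simp
end
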